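/- Let A(z_1,z_2;q) be a zero-weight, unitary dynamical matrix on V⊗V satisfying (YB-A), f : ℂ → ℂ, and define B entrywise by B_{(i,j),(k,l)}(z_1,z_2;q) = A_{(k,j),(i,l)}(f(z_1),z_2; q+μ e_k). Let H be a weight-graded complex vector space and T(z;q) an n×n matrix of End(H)-valued functions that is zero-weight for h^{(1)}+h^{(q)} and satisfies the bulk exchange relation A_{12}(z_1,z_2;q) T_1(z_1;q−h^{(2)}) T_2(z_2;q) = T_2(z_2;q−h^{(1)}) T_1(z_1;q) A_{12}(z_1,z_2;q−h^{(q)}) on V⊗V⊗H. Define 𝒯_{ij}(z;q) = T_{ji}(f(z); q+μe_j). Then the crossed exchange relation holds: 𝒯_1(z_1;q−h^{(2)}) B_{12}(z_1,z_2;q) T_2(z_2;q+h^{(1)}) = T_2(z_2;q) B_{12}(z_1,z_2;q−h^{(q)}) 𝒯_1(z_1;q) on V⊗V⊗H. -/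

import Mathlib

open scoped BigOperators

noncomputable section

namespace Paper

/-- Dynamical parameter space: `q : ℂ^n`. -/
abbrev Qn (n : ℕ) := Fin n → ℂ

/-- `End(V ⊗ V)` with `V = ℂ^n`, as matrices indexed by pairs. -/
abbrev DM (n : ℕ) := Matrix (Fin n × Fin n) (Fin n × Fin n) ℂ

/-- Index set for `V ⊗ V ⊗ V`. -/
abbrev I3 (n : ℕ) := Fin n × Fin n × Fin n

/-- Matrices on `V ⊗ V ⊗ V` with entries in `R`. -/
abbrev M3 (n : ℕ) (R : Type*) := Matrix (I3 n) (I3 n) R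

/-- Standard basis vector `e i` of `ℂ^n`. -/
def ee (n : ℕ) (i : Fin n) : Qn n := fun k => if k = i then 1 else 0

/-- Embedding of a (spectator-dependent) two-site matrix into sites 1,2 of
`V ⊗ V ⊗ V`; the argument of `X` is the index of the (spectator) third site. -/
def pl12 {n : ℕ} {R : Type*} [Zero R] (X : Fin n → Matrix (Fin n × Fin n) (Fin n × Fin n) R) :
    M3 n R :=
  Matrix.of fun p p' =>
    if p.2.2 = p'.2.2 then X p.2.2 (p.1, p.2.1) (p'.1, p'.2.1) else 0

/-- Embedding into sites 1,3; the spectator is the second site. -/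
def pl13 {n : ℕ} {R : Type*} [Zero R] (X : Fin n → Matrix (Fin n × Fin n) (Fin n × Fin n) R) :
    M3 n R :=
  Matrix.of fun p p' =>
    if p.2.1 = p'.2.1 then X p.2.1 (p.1, p.2.2) (p'.1, p'.2.2) else 0

/-- Embedding into sites 2,3; the spectator is the first site. -/
def pl23 {n : ℕ} {R : Type*} [Zero R] (X : Fin n → Matrix (Fin n × Fin n) (Fin n × Fin n) R) :
    M3 n R :=
  Matrix.of fun p p' =>
    if p.1 = p'.1 then X p.1 (p.2.1, p.2.2) (p'.2.1, p'.2.2) else 0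

/-- Conjugation by the flip `P`: `(P M P)_{(i,j),(k,l)} = M_{(j,i),(l,k)}`. -/
def swapDM {n : ℕ} {R : Type*} (M : Matrix (Fin n × Fin n) (Fin n × Fin n) R) :
    Matrix (Fin n × Fin n) (Fin n × Fin n) R :=
  Matrix.of fun p p' => M (p.2, p.1) (p'.2, p'.1)

/-- A dynamical matrix with two spectral parameters. -/
abbrev SDM (n : ℕ) := ℂ → ℂ → Qn n → DM n

/-- Zero-weight condition: entries vanish unless `e_i + e_j = e_k + e_l`. -/
def ZeroWeight {n : ℕ} (A : SDM n) : Prop :=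
  ∀ z1 z2 q i j k l, ee n i + ee n j ≠ ee n k + ee n l → A z1 z2 q (i, j) (k, l) = 0

/-- Weight condition for `B`/`C`: entries vanish unless `e_i - e_j = e_k - e_l`. -/
def BCWeight {n : ℕ} (B : SDM n) : Prop :=
  ∀ z1 z2 q i j k l, ee n i - ee n j ≠ ee n k - ee n l → B z1 z2 q (i, j) (k, l) = 0

/-- Unitarity: `A₁₂(z₁,z₂;q) A₂₁(z₂,z₁;q) = Id`. -/
def Unitary {n : ℕ} (A : SDM n) : Prop :=
  ∀ z1 z2 q, A z1 z2 q * swapDM (A z2 z1 q) = 1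

/-- (YB-A): `A₁₂(q) A₁₃(q-h²) A₂₃(q) = A₂₃(q-h¹) A₁₃(q) A₁₂(q-h³)`. -/
def YBA {n : ℕ} (μ : ℂ) (A : SDM n) : Prop :=
  ∀ z1 z2 z3 q,
    pl12 (fun _ => A z1 z2 q) * pl13 (fun m => A z1 z3 (q - μ • ee n m)) *
        pl23 (fun _ => A z2 z3 q) =
      pl23 (fun m => A z2 z3 (q - μ • ee n m)) * pl13 (fun _ => A z1 z3 q) *
        pl12 (fun m => A z1 z2 (q - μ • ee n m))

/-- (YB-D): `D₁₂(q+h³) D₁₃(q) D₂₃(q+h¹) = D₂₃(q) D₁₃(q+h²) D₁₂(q)`. -/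
def YBD {n : ℕ} (μ : ℂ) (D : SDM n) : Prop :=
  ∀ z1 z2 z3 q,
    pl12 (fun m => D z1 z2 (q + μ • ee n m)) * pl13 (fun _ => D z1 z3 q) *
        pl23 (fun m => D z2 z3 (q + μ • ee n m)) =
      pl23 (fun _ => D z2 z3 q) * pl13 (fun m => D z1 z3 (q + μ • ee n m)) *
        pl12 (fun _ => D z1 z2 q)

/-- (YB-AC): `A₁₂(q) C₁₃(q-h²) C₂₃(q) = C₂₃(q-h¹) C₁₃(q) A₁₂(q+h³)`. -/
def YBAC {n : ℕ} (μ : ℂ) (A C : SDM n) : Prop :=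
  ∀ z1 z2 z3 q,
    pl12 (fun _ => A z1 z2 q) * pl13 (fun m => C z1 z3 (q - μ • ee n m)) *
        pl23 (fun _ => C z2 z3 q) =
      pl23 (fun m => C z2 z3 (q - μ • ee n m)) * pl13 (fun _ => C z1 z3 q) *
        pl12 (fun m => A z1 z2 (q + μ • ee n m))

/-- (YB-DB): `D₁₂(q-h³) B₁₃(q) B₂₃(q+h¹) = B₂₃(q) B₁₃(q+h²) D₁₂(q)`. -/
def YBDB {n : ℕ} (μ : ℂ) (D B : SDM n) : Prop :=
  ∀ z1 z2 z3 q,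
    pl12 (fun m => D z1 z2 (q - μ • ee n m)) * pl13 (fun _ => B z1 z3 q) *
        pl23 (fun m => B z2 z3 (q + μ • ee n m)) =
      pl23 (fun _ => B z2 z3 q) * pl13 (fun m => B z1 z3 (q + μ • ee n m)) *
        pl12 (fun _ => D z1 z2 q)

/-- `C₁₂(z₁,z₂;q) = B₂₁(z₂,z₁;q)`. -/
def CisB21 {n : ℕ} (B C : SDM n) : Prop :=
  ∀ z1 z2 q, C z1 z2 q = swapDM (B z2 z1 q)

/-- `K₁` on `V ⊗ V` (values in `R`), with spectator-dependent argument: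
the argument of `X` is the index of the second (spectator) site. -/
def op1 {n : ℕ} {R : Type*} [Zero R] (X : Fin n → Matrix (Fin n) (Fin n) R) :
    Matrix (Fin n × Fin n) (Fin n × Fin n) R :=
  Matrix.of fun p p' => if p.2 = p'.2 then X p.2 p.1 p'.1 else 0

/-- `K₂` on `V ⊗ V`, the spectator being the first site. -/
def op2 {n : ℕ} {R : Type*} [Zero R] (X : Fin n → Matrix (Fin n) (Fin n) R) :
    Matrix (Fin n × Fin n) (Fin n × Fin n) R :=
  Matrix.of fun p p' => if p.1 = p'.1 then X p.1 p.2 p'.2 else 0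

/-- Scalar structure matrices viewed with entries in an algebra `R`. -/
def sc {n : ℕ} {R : Type*} [Semiring R] [Algebra ℂ R] (M : DM n) :
    Matrix (Fin n × Fin n) (Fin n × Fin n) R :=
  M.map (algebraMap ℂ R)

/-- The dynamical reflection equation (RE) for a matrix `K` of functions with
values in a `ℂ`-algebra `R`:
`A₁₂(q) K₁(q-h²) B₁₂(q) K₂(q+h¹) = K₂(q-h¹) C₁₂(q) K₁(q+h²) D₁₂(q)`. -/
def RE {n : ℕ} {R : Type*} [Semiring R] [Algebra ℂ R] (μ : ℂ) (A B C D : SDM n)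
    (K : ℂ → Qn n → Matrix (Fin n) (Fin n) R) : Prop :=
  ∀ z1 z2 q,
    sc (A z1 z2 q) * op1 (fun m => K z1 (q - μ • ee n m)) * sc (B z1 z2 q) *
        op2 (fun m => K z2 (q + μ • ee n m)) =
      op2 (fun m => K z2 (q - μ • ee n m)) * sc (C z1 z2 q) *
        op1 (fun m => K z1 (q + μ • ee n m)) * sc (D z1 z2 q)

/-- The `D` matrix built from `A` in Theorem 3.3:
`D_{(i,j),(k,l)}(z₁,z₂;q) = A_{(l,k),(j,i)}(f z₂, f z₁; q + μ(e_i+e_j))`. -/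
def Dmat {n : ℕ} (μ : ℂ) (f : ℂ → ℂ) (A : SDM n) : SDM n := fun z1 z2 q =>
  Matrix.of fun p p' =>
    A (f z2) (f z1) (q + μ • (ee n p.1 + ee n p.2))  (p'.2, p'.1) (p.2, p.1)

/-- `C_{(i,j),(k,l)}(z₁,z₂;q) = A_{(l,i),(j,k)}(f z₂, z₁; q + μ e_l)`. -/
def Cmat {n : ℕ} (μ : ℂ) (f : ℂ → ℂ) (A : SDM n) : SDM n := fun z1 z2 q =>
  Matrix.of fun p p' =>
    A (f z2) z1 (q + μ • ee n p'.2)  (p'.2, p.1) (p.2, p'.1)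

/-- `B_{(i,j),(k,l)}(z₁,z₂;q) = A_{(k,j),(i,l)}(f z₁, z₂; q + μ e_k)`. -/
def Bmat {n : ℕ} (μ : ℂ) (f : ℂ → ℂ) (A : SDM n) : SDM n := fun z1 z2 q =>
  Matrix.of fun p p' =>
    A (f z1) z2 (q + μ • ee n p'.1)  (p'.1, p.2) (p.1, p'.2)

attribute [local instance] Classical.propDecidable

open DirectSum

variable {n : ℕ}

/-- Operators on the weight-graded quantum space `H = ⨁_{λ} H_λ`. -/
abbrev EndH (n : ℕ) (Hf : (Fin n → ℂ) → Type*) [∀ l, AddCommGroup (Hf l)]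
    [∀ l, Module ℂ (Hf l)] :=
  Module.End ℂ (⨁ l, Hf l)

/-- For a family `F` of endomorphisms of `H` depending on `q`, the operator
`F(q + c·h^{(q)})`, acting on a vector of `H`-weight `λ` as `F(q + c λ)`
(take `c = ±μ` for `F(q ± h^{(q)})`, `c = αμ` for `F(q + α h^{(q)})`). -/
def qshift (Hf : (Fin n → ℂ) → Type*) [∀ l, AddCommGroup (Hf l)] [∀ l, Module ℂ (Hf l)]
    (F : (Fin n → ℂ) → EndH n Hf) (q : Fin n → ℂ) (c : ℂ) : EndH n Hf :=
  DirectSum.toModule ℂ (Fin n → ℂ) (⨁ l, Hf l)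
    (fun l => (F (q + c • l)).comp (DirectSum.lof ℂ (Fin n → ℂ) Hf l))

/-- Zero-weight condition for a quantum Lax matrix `T` under `h^{(1)} + h^{(q)}`:
`T_{ij}` maps `H_λ` into `H_{λ + e_j - e_i}`. -/
def LaxZeroWeight (Hf : (Fin n → ℂ) → Type*) [∀ l, AddCommGroup (Hf l)]
    [∀ l, Module ℂ (Hf l)]
    (T : ℂ → Qn n → Matrix (Fin n) (Fin n) (EndH n Hf)) : Prop :=
  ∀ z q (i j : Fin n) l x,
    T z q i j (DirectSum.lof ℂ (Fin n → ℂ) Hf l x) ∈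
      LinearMap.range (DirectSum.lof ℂ (Fin n → ℂ) Hf (l + ee n j - ee n i))

/-- The bulk dynamical exchange relation on `V ⊗ V ⊗ H`:
`A₁₂(z₁,z₂;q) T₁(z₁;q-h²) T₂(z₂;q) = T₂(z₂;q-h¹) T₁(z₁;q) A₁₂(z₁,z₂;q-h^{(q)})`. -/
def BulkRel (Hf : (Fin n → ℂ) → Type*) [∀ l, AddCommGroup (Hf l)]
    [∀ l, Module ℂ (Hf l)] (μ : ℂ) (A : SDM n)
    (T : ℂ → Qn n → Matrix (Fin n) (Fin n) (EndH n Hf)) : Prop :=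
  ∀ z1 z2 q,
    sc (A z1 z2 q) * op1 (fun m => T z1 (q - μ • ee n m)) *
        op2 (fun _ => T z2 q) =
      op2 (fun m => T z2 (q - μ • ee n m)) * op1 (fun _ => T z1 q) *
        Matrix.of (fun p p' =>
          qshift Hf (fun q' => (A z1 z2 q' p p') • (1 : EndH n Hf)) q (-μ))

/-- The transposed Lax matrix `𝒯_{ij}(z;q) = T_{ji}(f z; q + μ e_j)`. -/
def TLax (Hf : (Fin n → ℂ) → Type*) [∀ l, AddCommGroup (Hf l)] [∀ l, Module ℂ (Hf l)]
    (μ : ℂ) (f : ℂ → ℂ) (T : ℂ → Qn n → Matrix (Fin n) (Fin n) (EndH n Hf)) :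
    ℂ → Qn n → Matrix (Fin n) (Fin n) (EndH n Hf) :=
  fun z q => Matrix.of fun i j => T (f z) (q + μ • ee n j) j i


theorem qshift_lof (Hf : (Fin n → ℂ) → Type*) [∀ l, AddCommGroup (Hf l)]
    [∀ l, Module ℂ (Hf l)] (F : (Fin n → ℂ) → EndH n Hf) (q : Fin n → ℂ) (c : ℂ)
    (l : Fin n → ℂ) (x : Hf l) :
    qshift Hf F q c (DirectSum.lof ℂ (Fin n → ℂ) Hf l x) =
      F (q + c • l) (DirectSum.lof ℂ (Fin n → ℂ) Hf l x) := by
  simp [qshift, DirectSum.toModule_lof]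

/-- Moving a scalar dynamical function of the quantum weight across an entry of a zero-weight
Lax matrix shifts its argument. -/
theorem LaxZeroWeight.qshift_smul_mul {Hf : (Fin n → ℂ) → Type*} [∀ l, AddCommGroup (Hf l)]
    [∀ l, Module ℂ (Hf l)] {T : ℂ → Qn n → Matrix (Fin n) (Fin n) (EndH n Hf)}
    (hT : LaxZeroWeight Hf T) (g : Qn n → ℂ) (z c : ℂ) (q r : Qn n) (i j : Fin n) :
    qshift Hf (fun q' => g q' • (1 : EndH n Hf)) q c * T z r i j =
      T z r i j *
        qshift Hf (fun q' => g q' • (1 : EndH n Hf)) (q + c • (ee n j - ee n i)) c := by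
  refine DirectSum.linearMap_ext ℂ fun l => LinearMap.ext fun x => ?_
  obtain ⟨y, hy⟩ := hT z r i j l x
  have h : q + c • (l + ee n j - ee n i) = q + c • (ee n j - ee n i) + c • l := by module
  simp only [LinearMap.comp_apply, Module.End.mul_apply, qshift_lof, LinearMap.smul_apply,
    Module.End.one_apply, map_smul]
  rw [← hy, qshift_lof, h]
  rfl

section Entries

variable {R : Type*} [Semiring R]

theorem mul_op1_apply (M : Matrix (Fin n × Fin n) (Fin n × Fin n) R)
    (X : Fin n → Matrix (Fin n) (Fin n) R) (p : Fin n × Fin n) (k l : Fin n) :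
    (M * op1 X) p (k, l) = ∑ a, M p (a, l) * X l a k := by
  simp [Matrix.mul_apply, op1, Fintype.sum_prod_type]

theorem mul_op2_apply (M : Matrix (Fin n × Fin n) (Fin n × Fin n) R)
    (X : Fin n → Matrix (Fin n) (Fin n) R) (p : Fin n × Fin n) (k l : Fin n) :
    (M * op2 X) p (k, l) = ∑ b, M p (k, b) * X k b l := by
  rw [Matrix.mul_apply, Fintype.sum_prod_type_right]
  simp [op2]

theorem op1_mul_apply (X : Fin n → Matrix (Fin n) (Fin n) R)
    (M : Matrix (Fin n × Fin n) (Fin n × Fin n) R) (i j : Fin n) (p : Fin n × Fin n) :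
    (op1 X * M) (i, j) p = ∑ a, X j i a * M (a, j) p := by
  simp [Matrix.mul_apply, op1, Fintype.sum_prod_type]

theorem op2_mul_apply (X : Fin n → Matrix (Fin n) (Fin n) R)
    (M : Matrix (Fin n × Fin n) (Fin n × Fin n) R) (i j : Fin n) (p : Fin n × Fin n) :
    (op2 X * M) (i, j) p = ∑ b, X i j b * M (i, b) p := by
  rw [Matrix.mul_apply, Fintype.sum_prod_type_right]
  simp [op2]

end Entries

/-- crossed exchange relation, Theorem 3.4.  If `T` is a
zero-weight quantum Lax matrix for `A` on `V ⊗ V ⊗ H`, then with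
`𝒯_{ij}(z;q) = T_{ji}(f z; q+μ e_j)` the crossed relation holds:
`𝒯₁(z₁;q-h²) B₁₂(z₁,z₂;q) T₂(z₂;q+h¹) = T₂(z₂;q) B₁₂(z₁,z₂;q-h^{(q)}) 𝒯₁(z₁;q)`. -/
theorem statement3 {n : ℕ} (μ : ℂ) (A : SDM n) (f : ℂ → ℂ)
    (Hf : (Fin n → ℂ) → Type*) [∀ l, AddCommGroup (Hf l)] [∀ l, Module ℂ (Hf l)]
    (T : ℂ → Qn n → Matrix (Fin n) (Fin n) (EndH n Hf))
    (hZW : ZeroWeight A) (hU : Unitary A) (hYB : YBA μ A)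
    (hT : LaxZeroWeight Hf T) (hbulk : BulkRel Hf μ A T) :
    ∀ z1 z2 q,
      op1 (fun m => TLax Hf μ f T z1 (q - μ • ee n m)) * sc (Bmat μ f A z1 z2 q) *
          op2 (fun m => T z2 (q + μ • ee n m)) =
        op2 (fun _ => T z2 q) *
          Matrix.of (fun p p' =>
            qshift Hf (fun q' => (Bmat μ f A z1 z2 q' p p') • (1 : EndH n Hf)) q (-μ)) *
          op1 (fun _ => TLax Hf μ f T z1 q) := by
  intro z1 z2 q
  ext1 ⟨i, j⟩ ⟨k, l⟩
  have h := congrFun (congrFun (hbulk (f z1) z2 (q + μ • ee n k)) (k, j)) (i, l)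
  rw [Matrix.mul_assoc (op2 _)] at h
  simp only [mul_op2_apply, mul_op1_apply, op2_mul_apply, op1_mul_apply, Matrix.of_apply] at h
  rw [Matrix.mul_assoc (op2 _)]
  simp only [mul_op2_apply, mul_op1_apply, op2_mul_apply, op1_mul_apply, Matrix.of_apply]
  convert h using 1
  · refine Finset.sum_congr rfl fun b _ => ?_
    congr 1
    refine Finset.sum_congr rfl fun a _ => ?_
    simp only [sc, Matrix.map_apply, Bmat, TLax, Matrix.of_apply]
    by_cases hw : ee n k + ee n j = ee n a + ee n b
    · have hq : q - μ • ee n j + μ • ee n a = q + μ • ee n k - μ • ee n b := by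
        rw [← sub_eq_zero,
          show q - μ • ee n j + μ • ee n a - (q + μ • ee n k - μ • ee n b) =
            μ • (ee n a + ee n b - (ee n k + ee n j)) by module, hw, sub_self, smul_zero]
      rw [hq, Algebra.commutes]
    · simp [hZW _ _ _ _ _ _ _ hw]
  · refine Finset.sum_congr rfl fun b _ => ?_
    congr 1
    · simp
    · refine Finset.sum_congr rfl fun a _ => ?_
      simp only [Bmat, TLax, Matrix.of_apply]
      rw [hT.qshift_smul_mul (fun q' => A (f z1) z2 (q' + μ • ee n a) (a, b) (i, l))]
      congr 1
      refine DirectSum.linearMap_ext ℂ fun m => LinearMap.ext fun x => ?_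
      simp only [LinearMap.comp_apply, qshift_lof]
      rw [show q + -μ • (ee n a - ee n k) + -μ • m + μ • ee n a = q + μ • ee n k + -μ • m by
        module]

end Paper

end
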